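/- arXiv:2410.18604 — 2 statements merged into one kernel-verified Lean document; each statement's English description precedes it below -/
import Mathlib

section
/- For every i ∈ I there exists a unique F-algebra endomorphism σ_i of 𝒜 satisfying, for all m ∈ ℤ: σ_i(E_{i,m}) = E_{i,m+1}K_{i,m}^{−1}; σ_i(E_{j,m}) = (v^{1/2}E_{i,m}E_{j,m} − v^{−1/2}E_{j,m}E_{i,m})/(v − v^{−1}) whenever a_{ij} = −1; σ_i(E_{j,m}) = E_{j,m} whenever a_{ij} = 0; σ_i(K_{i,m}) = K_{i,m}^{−1}; σ_i(K_{j,m}) = K_{i,m}K_{j,m} whenever a_{ij} = −1; and σ_i(K_{j,m}) = K_{j,m} whenever a_{ij} = 0. (That is, the images of the generators under these formulas again satisfy the defining relations (SD0)–(SD5).) -/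
/-!
Braid group action on the twisted semi-derived Hall algebra (Contu, arXiv:2410.18604).

We work with the algebra `𝒜 = 𝒮𝒟ℋ_tw(C^b(𝒫))` given by its presentation
(Proposition `prop_presenentation_semiderived_E_i` of the paper): generators
`E_{i,m}`, `K_{i,m}`, `K_{i,m}⁻¹` (`i ∈ I`, `m ∈ ℤ`) over `F = ℚ(v^{1/2})`,
subject to the relations (SD0)–(SD5).
-/

noncomputable section

namespace SDHall

/-- The field `ℚ(v^{1/2})` of rational functions over `ℚ` in one indeterminate `v^{1/2}`. -/
abbrev F₀ : Type := RatFunc ℚ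

/-- The indeterminate `v^{1/2}`. -/
def sq : F₀ := RatFunc.X

/-- `v := (v^{1/2})²`. -/
def v : F₀ := sq ^ 2

/-- The sign `(-1)^n` for an integer `n`. -/
def sgn (n : ℤ) : ℤ := (((-1 : ℤˣ) ^ n : ℤˣ) : ℤ)

/-- Generators `E_{i,m}`, `K_{i,m}`, `K_{i,m}⁻¹` of the presented algebra. -/
inductive Gen (I : Type) : Type
  | E : I → ℤ → Gen I
  | K : I → ℤ → Gen I
  | Kinv : I → ℤ → Gen I

variable {I : Type}

def e (i : I) (m : ℤ) : FreeAlgebra F₀ (Gen I) := FreeAlgebra.ι F₀ (Gen.E i m)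
def κ (i : I) (m : ℤ) : FreeAlgebra F₀ (Gen I) := FreeAlgebra.ι F₀ (Gen.K i m)
def κ' (i : I) (m : ℤ) : FreeAlgebra F₀ (Gen I) := FreeAlgebra.ι F₀ (Gen.Kinv i m)

/-- The defining relations (SD0)–(SD5) of the twisted semi-derived Hall algebra:
(SD0) `K_{i,m}K_{i,m}⁻¹ = 1 = K_{i,m}⁻¹K_{i,m}`;
(SD1) each `K_{i,m}` is central;
(SD2) `E_{i,m}E_{j,m} = E_{j,m}E_{i,m}` if `a_{ij} = 0`;
(SD3) `E_{i,m}²E_{j,m} − (v+v⁻¹)E_{i,m}E_{j,m}E_{i,m} + E_{j,m}E_{i,m}² = 0` if `a_{ij} = −1`;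
(SD4) `E_{i,m+1}E_{j,m} = v^{a_{ij}}E_{j,m}E_{i,m+1} + δ_{ij}(1−v²)K_{i,m}`
      (split into the cases `i ≠ j` and `i = j`);
(SD5) `E_{j,r}E_{i,l} = v^{−(−1)^{r−l}a_{ij}}E_{i,l}E_{j,r}` for `r > l+1`. -/
inductive Rel (a : I → I → ℤ) : FreeAlgebra F₀ (Gen I) → FreeAlgebra F₀ (Gen I) → Prop
  | sd0a (i : I) (m : ℤ) : Rel a (κ i m * κ' i m) 1
  | sd0b (i : I) (m : ℤ) : Rel a (κ' i m * κ i m) 1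
  | sd1 (i : I) (m : ℤ) (x : FreeAlgebra F₀ (Gen I)) : Rel a (κ i m * x) (x * κ i m)
  | sd2 (i j : I) (m : ℤ) : a i j = 0 → Rel a (e i m * e j m) (e j m * e i m)
  | sd3 (i j : I) (m : ℤ) : a i j = -1 →
      Rel a (e i m ^ 2 * e j m - (v + v⁻¹) • (e i m * e j m * e i m) + e j m * e i m ^ 2) 0
  | sd4_ne (i j : I) (m : ℤ) : i ≠ j →
      Rel a (e i (m + 1) * e j m) ((v ^ (a i j)) • (e j m * e i (m + 1)))
  | sd4_eq (i : I) (m : ℤ) :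
      Rel a (e i (m + 1) * e i m)
        ((v ^ (a i i)) • (e i m * e i (m + 1)) + ((1 : F₀) - v ^ 2) • κ i m)
  | sd5 (i j : I) (r l : ℤ) : r > l + 1 →
      Rel a (e j r * e i l) ((v ^ (-(sgn (r - l)) * a i j)) • (e i l * e j r))

/-- The twisted semi-derived Hall algebra `𝒜`, presented by generators and relations. -/
abbrev A (a : I → I → ℤ) : Type := RingQuot (Rel a)

/-- The generator `E_{i,m}` of `𝒜`. -/
def E (a : I → I → ℤ) (i : I) (m : ℤ) : A a := RingQuot.mkAlgHom F₀ (Rel a) (e i m)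

/-- The generator `K_{i,m}` of `𝒜`. -/
def K (a : I → I → ℤ) (i : I) (m : ℤ) : A a := RingQuot.mkAlgHom F₀ (Rel a) (κ i m)

/-- The generator `K_{i,m}⁻¹` of `𝒜`. -/
def Kinv (a : I → I → ℤ) (i : I) (m : ℤ) : A a := RingQuot.mkAlgHom F₀ (Rel a) (κ' i m)

/-- `a` is a simply-laced generalized Cartan matrix: symmetric, `a_{ii} = 2`,
and `a_{ij} ∈ {0, −1}` for `i ≠ j`. -/
def IsCartan (a : I → I → ℤ) : Prop :=
  (∀ i j, a i j = a j i) ∧ (∀ i, a i i = 2) ∧ ∀ i j, i ≠ j → a i j = 0 ∨ a i j = -1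

/-- The element `(v^{1/2}E_{i,m}E_{j,m} − v^{−1/2}E_{j,m}E_{i,m})/(v − v^{−1})` of `𝒜`. -/
def T (a : I → I → ℤ) (i j : I) (m : ℤ) : A a :=
  (v - v⁻¹)⁻¹ • (sq • (E a i m * E a j m) - sq⁻¹ • (E a j m * E a i m))

/-- The defining formulas for the braid group operator `σᵢ` on the generators:
`σᵢ(E_{i,m}) = E_{i,m+1}K_{i,m}⁻¹`;
`σᵢ(E_{j,m}) = (v^{1/2}E_{i,m}E_{j,m} − v^{−1/2}E_{j,m}E_{i,m})/(v − v^{−1})` if `a_{ij} = −1`;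
`σᵢ(E_{j,m}) = E_{j,m}` if `a_{ij} = 0`;
`σᵢ(K_{i,m}) = K_{i,m}⁻¹`; `σᵢ(K_{j,m}) = K_{i,m}K_{j,m}` if `a_{ij} = −1`;
`σᵢ(K_{j,m}) = K_{j,m}` if `a_{ij} = 0`. -/
def SigmaSpec (a : I → I → ℤ) (i : I) (σ : A a →ₐ[F₀] A a) : Prop :=
  (∀ m : ℤ, σ (E a i m) = E a i (m + 1) * Kinv a i m) ∧
  (∀ (j : I) (m : ℤ), a i j = -1 → σ (E a j m) = T a i j m) ∧
  (∀ (j : I) (m : ℤ), a i j = 0 → σ (E a j m) = E a j m) ∧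
  (∀ m : ℤ, σ (K a i m) = Kinv a i m) ∧
  (∀ (j : I) (m : ℤ), a i j = -1 → σ (K a j m) = K a i m * K a j m) ∧
  (∀ (j : I) (m : ℤ), a i j = 0 → σ (K a j m) = K a j m)

/-- The defining formulas for the inverse operator `σᵢ'` on the generators:
`σᵢ'(E_{i,m}) = E_{i,m−1}K_{i,m−1}⁻¹`;
`σᵢ'(E_{j,m}) = (v^{1/2}E_{j,m}E_{i,m} − v^{−1/2}E_{i,m}E_{j,m})/(v − v^{−1})` if `a_{ij} = −1`;
`σᵢ'(E_{j,m}) = E_{j,m}` if `a_{ij} = 0`;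
`σᵢ'(K_{i,m}) = K_{i,m}⁻¹`; `σᵢ'(K_{j,m}) = K_{i,m}K_{j,m}` if `a_{ij} = −1`;
`σᵢ'(K_{j,m}) = K_{j,m}` if `a_{ij} = 0`. -/
def SigmaSpec' (a : I → I → ℤ) (i : I) (σ : A a →ₐ[F₀] A a) : Prop :=
  (∀ m : ℤ, σ (E a i m) = E a i (m - 1) * Kinv a i (m - 1)) ∧
  (∀ (j : I) (m : ℤ), a i j = -1 → σ (E a j m) = T a j i m) ∧
  (∀ (j : I) (m : ℤ), a i j = 0 → σ (E a j m) = E a j m) ∧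
  (∀ m : ℤ, σ (K a i m) = Kinv a i m) ∧
  (∀ (j : I) (m : ℤ), a i j = -1 → σ (K a j m) = K a i m * K a j m) ∧
  (∀ (j : I) (m : ℤ), a i j = 0 → σ (K a j m) = K a j m)

end SDHall

open SDHall

set_option linter.unusedSimpArgs false
set_option linter.unnecessarySeqFocus false

namespace SDAux

section gen
variable {F R : Type*} [Field F] [Ring R] [Algebra F R]

/-- left-associated rewriting from a relation -/
theorem assoc_rule {x a a' : R} {t : F} (h : x * a = a' + t • (a * x)) (r : R) :
    x * (a * r) = a' * r + t • (a * (x * r)) := by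
  rw [← mul_assoc, h, add_mul, smul_mul_assoc, mul_assoc]

theorem assoc_rule0 {x a : R} {t : F} (h : x * a = t • (a * x)) (r : R) :
    x * (a * r) = t • (a * (x * r)) := by
  rw [← mul_assoc, h, smul_mul_assoc, mul_assoc]

theorem bi (x a b a' b' : R) (t : F) (ht : t ≠ 0)
    (ha : x * a = a' + t • (a * x)) (ha' : x * a' = t⁻¹ • (a' * x))
    (hb : x * b = b' + t • (b * x)) (hb' : x * b' = t⁻¹ • (b' * x)) :
    x * (x * (a * b)) - (1 + t ^ 2) • (x * ((a * b) * x)) + t ^ 2 • ((a * b) * (x * x))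
      = (t + t⁻¹) • (a' * b') := by
  simp only [mul_assoc, mul_add, add_mul, mul_smul_comm, smul_mul_assoc, smul_add, smul_smul,
    ha, ha', hb, hb', assoc_rule ha, assoc_rule0 ha', assoc_rule hb, assoc_rule0 hb']
  match_scalars <;> field_simp <;> ring

theorem biz (x a b z a' b' : R) (t : F) (ht : t ≠ 0)
    (ha : x * a = a' + t • (a * x)) (ha' : x * a' = t⁻¹ • (a' * x))
    (hb : x * b = b' + t • (b * x)) (hb' : x * b' = t⁻¹ • (b' * x))
    (hz : x * z = (1 : F) • (z * x)) :
    (x * (x * (a * b * z)) - (1 + t ^ 2) • (x * ((a * b * z) * x))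
      + t ^ 2 • ((a * b * z) * (x * x)) = (t + t⁻¹) • (a' * b' * z)) ∧ 
    (x * (x * (a * z * b)) - (1 + t ^ 2) • (x * ((a * z * b) * x))
      + t ^ 2 • ((a * z * b) * (x * x)) = (t + t⁻¹) • (a' * z * b')) ∧ 
    (x * (x * (z * a * b)) - (1 + t ^ 2) • (x * ((z * a * b) * x))
      + t ^ 2 • ((z * a * b) * (x * x)) = (t + t⁻¹) • (z * a' * b')) := by
  refine ⟨?_, ?_, ?_⟩ <;>
  · simp only [mul_assoc, mul_add, add_mul, mul_smul_comm, smul_mul_assoc, smul_add, smul_smul,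
      ha, ha', hb, hb', assoc_rule ha, assoc_rule0 ha', assoc_rule hb, assoc_rule0 hb', hz,
      assoc_rule0 hz]
    match_scalars <;> field_simp <;> ring

theorem tri (x a b c a' b' c' : R) (t : F) (ht : t ≠ 0)
    (ha : x * a = a' + t • (a * x)) (ha' : x * a' = t⁻¹ • (a' * x))
    (hb : x * b = b' + t • (b * x)) (hb' : x * b' = t⁻¹ • (b' * x))
    (hc : x * c = c' + t • (c * x)) (hc' : x * c' = t⁻¹ • (c' * x)) :
    x * (x * (x * (a * b * c))) - (t⁻¹ + t + t ^ 3) • (x * (x * ((a * b * c) * x)))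
      + (1 + t ^ 2 + t ^ 4) • (x * ((a * b * c) * (x * x)))
      - t ^ 3 • ((a * b * c) * (x * (x * x)))
      = ((t + t⁻¹) * (t ^ 2 + 1 + (t ^ 2)⁻¹)) • (a' * b' * c') := by
  simp only [mul_assoc, mul_add, add_mul, mul_smul_comm, smul_mul_assoc, smul_add, smul_smul,
    ha, ha', hb, hb', hc, hc', assoc_rule ha, assoc_rule0 ha', assoc_rule hb, assoc_rule0 hb',
    assoc_rule hc, assoc_rule0 hc']
  match_scalars <;> field_simp <;> ring

/-- commutation of the images of two commuting neighbours -/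
theorem comm_of (x a b a' b' : R) (t : F) (ht : t ≠ 0) (h2 : t + t⁻¹ ≠ 0)
    (ha : x * a = a' + t • (a * x)) (ha' : x * a' = t⁻¹ • (a' * x))
    (hb : x * b = b' + t • (b * x)) (hb' : x * b' = t⁻¹ • (b' * x))
    (hab : a * b = b * a) : a' * b' = b' * a' := by
  have h := bi x a b a' b' t ht ha ha' hb hb'
  rw [hab, bi x b a b' a' t ht hb hb' ha ha'] at h
  exact (smul_right_injective R h2 h).symm

/-- Serre relation -/
def Serre (q : F) (a b : R) : Prop :=
  a ^ 2 * b - (q + q⁻¹) • (a * b * a) + b * a ^ 2 = 0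

theorem Serre.smul {q : F} {a b : R} (h : Serre q a b) (c d : F) : Serre q (c • a) (d • b) := by
  unfold Serre at *
  have : (c ^ 2 * d) • (a ^ 2 * b - (q + q⁻¹) • (a * b * a) + b * a ^ 2) = 0 := by
    rw [h, smul_zero]
  rw [← this]
  simp only [pow_two, mul_assoc, mul_add, add_mul, mul_smul_comm, smul_mul_assoc, smul_add,
    smul_smul, smul_sub]
  match_scalars <;> ring

theorem Serre.eq {q : F} {a b : R} (h : Serre q a b) :
    b * a * a = (q + q⁻¹) • (a * b * a) - a * a * b := by
  unfold Serre at h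
  rw [pow_two, ← mul_assoc] at h
  rw [← sub_eq_zero, ← h]
  simp only [mul_assoc]
  module

/-- consequence: `x a' = t⁻¹ a' x` -/
theorem Serre.left {q : F} {x a a' : R} {t : F} (ht : t ≠ 0) (hq : q = t⁻¹)
    (h : Serre q x a) (ha : x * a = a' + t • (a * x)) : x * a' = t⁻¹ • (a' * x) := by
  have e : a' = x * a - t • (a * x) := by rw [ha]; abel
  unfold Serre at h
  subst hq
  have : x * a' - t⁻¹ • (a' * x) = 0 := by
    rw [← h, e]
    simp only [pow_two, mul_assoc, mul_sub, sub_mul, mul_smul_comm, smul_mul_assoc, smul_sub,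
      smul_smul]
    match_scalars <;> field_simp <;> ring
  exact sub_eq_zero.mp this

theorem Serre.right {q : F} {x y a' : R} (hq : q ≠ 0)
    (h : Serre q y x) (ha : a' = x * y - q⁻¹ • (y * x)) : a' * y = q • (y * a') := by
  unfold Serre at h
  have : a' * y - q • (y * a') = 0 := by
    rw [← h, ha]
    simp only [pow_two, mul_assoc, mul_sub, sub_mul, mul_smul_comm, smul_mul_assoc, smul_sub,
      smul_smul]
    match_scalars <;> field_simp <;> ring
  exact sub_eq_zero.mp this

theorem serre3 (x a b a' b' : R) (t q : F) (ht : t ≠ 0) (h2 : t + t⁻¹ ≠ 0)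
    (h3 : t ^ 2 + 1 + (t ^ 2)⁻¹ ≠ 0)
    (ha : x * a = a' + t • (a * x)) (ha' : x * a' = t⁻¹ • (a' * x))
    (hb : x * b = b' + t • (b * x)) (hb' : x * b' = t⁻¹ • (b' * x))
    (h : Serre q a b) : Serre q a' b' := by
  have e1 := tri x a a b a' a' b' t ht ha ha' ha ha' hb hb'
  have e2 := tri x a b a a' b' a' t ht ha ha' hb hb' ha ha'
  have e3 := tri x b a a b' a' a' t ht hb hb' ha ha' ha ha'
  rw [h.eq] at e3
  have hne := mul_ne_zero h2 h3
  unfold Serre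
  apply smul_right_injective R hne
  simp only [smul_zero]
  have : ((t + t⁻¹) * (t ^ 2 + 1 + (t ^ 2)⁻¹)) • 
     (a' ^ 2 * b' - (q + q⁻¹) • (a' * b' * a') + b' * a' ^ 2) = 
     ((t + t⁻¹) * (t ^ 2 + 1 + (t ^ 2)⁻¹)) • (a' * a' * b') 
     - (q + q⁻¹) • ((t + t⁻¹) * (t ^ 2 + 1 + (t ^ 2)⁻¹)) • (a' * b' * a')
     + ((t + t⁻¹) * (t ^ 2 + 1 + (t ^ 2)⁻¹)) • (b' * a' * a') := by
    simp only [pow_two, mul_assoc]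
    module
  rw [this, ← e1, ← e2, ← e3]
  simp only [mul_assoc, mul_sub, sub_mul, mul_smul_comm, smul_mul_assoc]
  module

theorem serre2 (x a z a' : R) (t q : F) (ht : t ≠ 0) (h2 : t + t⁻¹ ≠ 0)
    (ha : x * a = a' + t • (a * x)) (ha' : x * a' = t⁻¹ • (a' * x))
    (hz : x * z = z * x)
    (h : Serre q a z) : Serre q a' z := by
  obtain ⟨e1, e2, e3⟩ := biz x a a z a' a' t ht ha ha' ha ha' (by rw [one_smul, hz])
  rw [h.eq] at e3
  unfold Serre
  apply smul_right_injective R h2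
  simp only [smul_zero]
  have : (t + t⁻¹) • 
     (a' ^ 2 * z - (q + q⁻¹) • (a' * z * a') + z * a' ^ 2) = 
     (t + t⁻¹) • (a' * a' * z) 
     - (q + q⁻¹) • (t + t⁻¹) • (a' * z * a')
     + (t + t⁻¹) • (z * a' * a') := by
    simp only [pow_two, mul_assoc]
    module
  rw [this, ← e1, ← e2, ← e3]
  simp only [mul_assoc, mul_sub, sub_mul, mul_smul_comm, smul_mul_assoc]
  module

theorem serre1 (x a z a' : R) (t q : F) 
    (ha : x * a = a' + t • (a * x)) (hz : x * z = z * x)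
    (h : Serre q z a) : Serre q z a' := by
  have e : a' = x * a - t • (a * x) := by rw [ha]; abel
  have hz' : ∀ r, x * (z * r) = z * (x * r) := fun r => by rw [← mul_assoc, hz, mul_assoc]
  unfold Serre at *
  have : x * (z ^ 2 * a - (q + q⁻¹) • (z * a * z) + a * z ^ 2) - 
     t • ((z ^ 2 * a - (q + q⁻¹) • (z * a * z) + a * z ^ 2) * x) = 0 := by rw [h]; simp
  rw [← this, e]
  simp only [pow_two, mul_assoc, mul_sub, sub_mul, mul_add, add_mul, mul_smul_comm,
    smul_mul_assoc, hz, hz']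
  module

/-- `X T = v T X + y`, `X y = v⁻¹ y X`, `T y = v y T` give both Serre relations. -/
theorem serreXT (X T y : R) (q : F) (hq : q ≠ 0) (h1 : X * T = y + q • (T * X))
    (h2 : X * y = q⁻¹ • (y * X)) : Serre q X T := by
  unfold Serre
  simp only [pow_two, mul_assoc, mul_add, add_mul, mul_smul_comm, smul_mul_assoc, smul_add,
    smul_smul, h1, h2, assoc_rule h1, assoc_rule0 h2]
  match_scalars <;> field_simp <;> ring

theorem serreTX (X T y : R) (q : F) (hq : q ≠ 0) (h1 : X * T = y + q • (T * X))
    (h3 : T * y = q • (y * T)) : Serre q T X := by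
  unfold Serre
  simp only [pow_two, mul_assoc, mul_add, add_mul, mul_smul_comm, smul_mul_assoc, smul_add,
    smul_smul, h1, h3, assoc_rule h1, assoc_rule0 h3]
  match_scalars <;> field_simp <;> ring

/-- the degree shift-one computation. -/
theorem shift_one (s : F) (hs : s ≠ 0) (hc : s ^ 2 - (s ^ 2)⁻¹ ≠ 0) (x y X Y K L t T : R)
    (hK : ∀ r, K * r = r * K) (hL : ∀ r, L * r = r * L)
    (hxx : X * x = (1 - (s ^ 2) ^ 2) • K + ((s ^ 2) ^ 2) • (x * X))
    (hyy : Y * y = (1 - (s ^ 2) ^ 2) • L + ((s ^ 2) ^ 2) • (y * Y))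
    (hxy : X * y = (s ^ 2)⁻¹ • (y * X)) (hyx : Y * x = (s ^ 2)⁻¹ • (x * Y))
    (ht : t = (s ^ 2 - (s ^ 2)⁻¹)⁻¹ • (s • (x * y) - s⁻¹ • (y * x)))
    (hT : T = (s ^ 2 - (s ^ 2)⁻¹)⁻¹ • (s • (X * Y) - s⁻¹ • (Y * X))) :
    T * x = s ^ 2 • (x * T) ∧ 
    T * t = (s ^ 2) ^ 2 • (t * T) + (1 - (s ^ 2) ^ 2) • (K * L) ∧ 
    X * t = (s⁻¹ * (1 - (s ^ 2) ^ 2)) • (K * y) + s ^ 2 • (t * X) := by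
  obtain ⟨c, hc'⟩ : ∃ c : F, c = (s ^ 2 - (s ^ 2)⁻¹)⁻¹ := ⟨_, rfl⟩
  have hcc : c * (s ^ 4 - 1) = s ^ 2 := by
    rw [hc']
    have : s ^ 4 - 1 = (s ^ 2 - (s ^ 2)⁻¹) * s ^ 2 := by field_simp
    rw [this, ← mul_assoc, inv_mul_cancel₀ hc, one_mul]
  have hKx := fun r r' : R => show r * (K * r') = K * (r * r') by rw [← mul_assoc, ← hK, mul_assoc]
  have hLx := fun r r' : R => show r * (L * r') = L * (r * r') by rw [← mul_assoc, ← hL, mul_assoc]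
  rw [← hc'] at ht hT
  have k1 : x * K = K * x := (hK x).symm
  have k2 : y * K = K * y := (hK y).symm
  have k3 : X * K = K * X := (hK X).symm
  have k4 : Y * K = K * Y := (hK Y).symm
  have l1 : x * L = L * x := (hL x).symm
  have l2 : y * L = L * y := (hL y).symm
  have l3 : X * L = L * X := (hL X).symm
  have l4 : Y * L = L * Y := (hL Y).symm
  have kl : L * K = K * L := (hK L).symm
  have m1 := hKx x
  have m2 := hKx y
  have m3 := hKx X
  have m4 := hKx Y
  have m5 := hKx L
  have n1 := hLx x
  have n2 := hLx y
  have n3 := hLx X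
  have n4 := hLx Y
  have hx : T * x = s ^ 2 • (x * T) := by
    rw [hT]
    simp only [mul_assoc, mul_add, add_mul, mul_sub, sub_mul, mul_smul_comm, smul_mul_assoc,
      smul_add, smul_sub, smul_smul, hxx, hyx, assoc_rule hxx, assoc_rule0 hyx, k1, k2, k3, k4,
      m1, m2, m3, m4]
    match_scalars <;> field_simp <;> ring
  have hy : T * y = (s⁻¹ * (1 - (s ^ 2) ^ 2)) • (L * X) + s ^ 2 • (y * T) := by
    rw [hT]
    simp only [mul_assoc, mul_add, add_mul, mul_sub, sub_mul, mul_smul_comm, smul_mul_assoc,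
      smul_add, smul_sub, smul_smul, hyy, hxy, assoc_rule hyy, assoc_rule0 hxy, l1, l2, l3, l4,
      n1, n2, n3, n4]
    match_scalars
    · field_simp
      linear_combination (1 - s ^ 4) * hcc
    all_goals field_simp
    all_goals try ring
  refine ⟨hx, ?_, ?_⟩
  · rw [ht]
    simp only [mul_assoc, mul_add, add_mul, mul_sub, sub_mul, mul_smul_comm, smul_mul_assoc,
      smul_add, smul_sub, smul_smul, hx, hy, assoc_rule hy, assoc_rule0 hx, hxx, l1, l2, l3, l4,
      n1, n2, n3, n4, kl]
    match_scalars <;> field_simp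
    all_goals try ring
    linear_combination (1 - s ^ 4) * hcc
  · rw [ht]
    simp only [mul_assoc, mul_add, add_mul, mul_sub, sub_mul, mul_smul_comm, smul_mul_assoc,
      smul_add, smul_sub, smul_smul, hxx, hxy, assoc_rule hxx, assoc_rule0 hxy, k1, k2, k3, k4,
      m1, m2, m3, m4]
    match_scalars
    · field_simp
      linear_combination (1 - s ^ 4) * hcc
    all_goals field_simp
    all_goals try ring

theorem qc_right {p x y t : R} {k c d α β : F} (hx : p * x = c • (x * p)) (hy : p * y = d • (y * p))
    (ht : t = k • (α • (x * y) - β • (y * x))) : p * t = (c * d) • (t * p) := by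
  rw [ht]
  simp only [mul_assoc, mul_sub, sub_mul, mul_smul_comm, smul_mul_assoc, smul_sub, smul_smul,
    hx, hy, assoc_rule0 hx, assoc_rule0 hy]
  module

theorem qc_left {p x y t : R} {k c d α β : F} (hx : x * p = c • (p * x)) (hy : y * p = d • (p * y))
    (ht : t = k • (α • (x * y) - β • (y * x))) : t * p = (c * d) • (p * t) := by
  rw [ht]
  simp only [mul_assoc, mul_sub, sub_mul, mul_smul_comm, smul_mul_assoc, smul_sub, smul_smul,
    hx, hy, assoc_rule0 hx, assoc_rule0 hy]
  module

end gen
end SDAux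

namespace SDAux
open SDHall

theorem poly_ne (p : Polynomial ℚ) (hp : p.eval 2 ≠ 0) : algebraMap (Polynomial ℚ) F₀ p ≠ 0 := by
  intro h
  have : p = 0 := by
    apply RatFunc.algebraMap_injective ℚ
    rw [h, map_zero]
  apply hp
  rw [this]
  simp

theorem sq_ne : sq ≠ 0 := RatFunc.X_ne_zero

theorem v_ne : v ≠ 0 := pow_ne_zero 2 sq_ne

theorem v4_ne : v ^ 2 - 1 ≠ 0 := by
  have := poly_ne ((Polynomial.X ^ 2) ^ 2 - 1) (by norm_num)
  simpa [v, SDHall.sq] using this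

theorem v4_ne' : v ^ 2 + 1 ≠ 0 := by
  have := poly_ne ((Polynomial.X ^ 2) ^ 2 + 1) (by norm_num)
  simpa [v, SDHall.sq] using this

theorem v8_ne : 1 + v ^ 2 + v ^ 4 ≠ 0 := by
  have := poly_ne (1 + (Polynomial.X ^ 2) ^ 2 + (Polynomial.X ^ 2) ^ 4) (by norm_num)
  simpa [v, SDHall.sq] using this

theorem c_ne : v - v⁻¹ ≠ 0 := by
  have h := v_ne
  have h' := v4_ne
  intro h0
  apply h'
  field_simp at h0
  linear_combination h0

theorem two_ne : v⁻¹ + (v⁻¹)⁻¹ ≠ 0 := by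
  have h := v_ne
  have h' := v4_ne'
  intro h0
  apply h'
  field_simp at h0
  linear_combination h0

theorem three_ne : (v⁻¹) ^ 2 + 1 + ((v⁻¹) ^ 2)⁻¹ ≠ 0 := by
  have h := v_ne
  have h' := v8_ne
  intro h0
  apply h'
  field_simp at h0
  linear_combination h0

theorem sgn_one : sgn 1 = -1 := by simp [sgn]

theorem sgn_succ (n : ℤ) : sgn (n + 1) = - sgn n := by
  simp [sgn, zpow_add]

theorem sgn_pred (n : ℤ) : sgn (n - 1) = - sgn n := by
  have := sgn_succ (n - 1)
  rw [sub_add_cancel] at this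
  omega

section alg
variable {I : Type} {a : I → I → ℤ}

theorem mk_rel {x y : FreeAlgebra F₀ (Gen I)} (h : Rel a x y) :
    RingQuot.mkAlgHom F₀ (Rel a) x = RingQuot.mkAlgHom F₀ (Rel a) y :=
  RingQuot.mkAlgHom_rel F₀ h

theorem K_Kinv (i : I) (m : ℤ) : K a i m * Kinv a i m = 1 := by
  simpa [K, Kinv] using mk_rel (a := a) (Rel.sd0a i m)

theorem Kinv_K (i : I) (m : ℤ) : Kinv a i m * K a i m = 1 := by
  simpa [K, Kinv] using mk_rel (a := a) (Rel.sd0b i m)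

theorem K_comm (i : I) (m : ℤ) (x : A a) : K a i m * x = x * K a i m := by
  obtain ⟨x, rfl⟩ := RingQuot.mkAlgHom_surjective F₀ (Rel a) x
  simpa [K] using mk_rel (a := a) (Rel.sd1 i m x)

theorem Kinv_comm (i : I) (m : ℤ) (x : A a) : Kinv a i m * x = x * Kinv a i m := by
  calc Kinv a i m * x = Kinv a i m * x * (K a i m * Kinv a i m) := by rw [K_Kinv, mul_one]
    _ = Kinv a i m * (x * K a i m) * Kinv a i m := by simp only [mul_assoc]
    _ = Kinv a i m * K a i m * x * Kinv a i m := by rw [← K_comm]; simp only [mul_assoc]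
    _ = _ := by rw [Kinv_K, one_mul]

theorem E_comm {i j : I} (m : ℤ) (h : a i j = 0) : E a i m * E a j m = E a j m * E a i m := by
  simpa [E] using mk_rel (a := a) (Rel.sd2 i j m h)

theorem E_serre {i j : I} (m : ℤ) (h : a i j = -1) : Serre v (E a i m) (E a j m) := by
  simpa [E, Serre] using mk_rel (a := a) (Rel.sd3 i j m h)

theorem E_eq (hA : IsCartan a) (i : I) (m : ℤ) : E a i (m + 1) * E a i m =
    (1 - v ^ 2) • K a i m + v ^ 2 • (E a i m * E a i (m + 1)) := by
  have := mk_rel (a := a) (Rel.sd4_eq i m)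
  rw [hA.2.1 i] at this
  rw [add_comm ((1 - v ^ 2) • K a i m)]
  simpa [E, K] using this

theorem E_q (hA : IsCartan a) (j k : I) (r l : ℤ) (h : l < r) (h' : r = l + 1 → j ≠ k) :
    E a j r * E a k l = v ^ (-(sgn (r - l)) * a j k) • (E a k l * E a j r) := by
  by_cases hr : r = l + 1
  · subst hr
    have := mk_rel (a := a) (Rel.sd4_ne j k l (h' rfl))
    have e : -(sgn (l + 1 - l)) * a j k = a j k := by
      rw [add_sub_cancel_left, sgn_one]; ring
    rw [e]
    simpa [E] using this
  · have := mk_rel (a := a) (Rel.sd5 k j r l (by omega))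
    rw [hA.1 j k]
    simpa [E] using this

/-- The unnormalised `T`. -/
def T' (a : I → I → ℤ) (i j : I) (m : ℤ) : A a :=
  E a i m * E a j m - v⁻¹ • (E a j m * E a i m)

theorem T_eq (i j : I) (m : ℤ) : T a i j m = ((v - v⁻¹)⁻¹ * sq) • T' a i j m := by
  have := sq_ne
  rw [T, T', smul_sub, smul_sub, smul_smul, smul_smul, smul_smul]
  congr 2
  rw [mul_assoc]
  congr 1
  rw [v]
  field_simp

theorem E_T' (i j : I) (m : ℤ) :
    E a i m * E a j m = T' a i j m + v⁻¹ • (E a j m * E a i m) := by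
  rw [T']; abel

theorem E_T'_q {i j : I} (m : ℤ) (h : a i j = -1) :
    E a i m * T' a i j m = (v⁻¹)⁻¹ • (T' a i j m * E a i m) :=
  Serre.left (inv_ne_zero v_ne) (inv_inv v).symm (E_serre m h) (E_T' i j m)

/-- `T X = v⁻¹ X T`. -/
theorem T_E_same {i j : I} (m : ℤ) (h : a i j = -1) :
    T a i j m * E a i m = v⁻¹ • (E a i m * T a i j m) := by
  rw [T_eq, mul_smul_comm, E_T'_q m h, smul_mul_assoc, inv_inv, smul_comm (_ * _) v, smul_smul v⁻¹,
    inv_mul_cancel₀ v_ne, one_smul]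

/-- `T y = v y T`. -/
theorem T_E_same' (hA : IsCartan a) {i j : I} (m : ℤ) (h : a i j = -1) :
    T a i j m * E a j m = v • (E a j m * T a i j m) := by
  have hs := E_serre (a := a) (i := j) (j := i) m (by rw [hA.1, h])
  rw [T_eq, mul_smul_comm, smul_mul_assoc, smul_comm v, Serre.right v_ne hs (rfl : T' a i j m = _)]

theorem shift (hA : IsCartan a) {i j : I} (m : ℤ) (h : a i j = -1) :
    T a i j (m + 1) * E a i m = v • (E a i m * T a i j (m + 1)) ∧
    T a i j (m + 1) * T a i j m = v ^ 2 • (T a i j m * T a i j (m + 1))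
      + (1 - v ^ 2) • (K a i m * K a j m) ∧
    E a i (m + 1) * T a i j m = (sq⁻¹ * (1 - v ^ 2)) • (K a i m * E a j m)
      + v • (T a i j m * E a i (m + 1)) := by
  have hij : i ≠ j := by
    rintro rfl
    rw [hA.2.1] at h
    omega
  have e1 := E_q hA i j (m + 1) m (by omega) (fun _ => hij)
  have e2 := E_q hA j i (m + 1) m (by omega) (fun _ => hij.symm)
  rw [add_sub_cancel_left, sgn_one, h] at e1
  rw [add_sub_cancel_left, sgn_one, hA.1, h] at e2
  norm_num at e1 e2
  exact shift_one sq sq_ne c_ne (E a i m) (E a j m) (E a i (m + 1)) (E a j (m + 1))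
    (K a i m) (K a j m) (T a i j m) (T a i j (m + 1)) (K_comm i m) (K_comm j m)
    (E_eq hA i m) (E_eq hA j m) e1 e2 rfl rfl

theorem T_Ei (hA : IsCartan a) {i j : I} (r l : ℤ) (hl : l < r) (h : a i j = -1) :
    T a i j r * E a i l = v ^ (-(sgn (r - l))) • (E a i l * T a i j r) := by
  by_cases hr : r = l + 1
  · subst hr
    rw [add_sub_cancel_left, sgn_one, neg_neg, zpow_one]
    exact (shift hA l h).1
  · rw [qc_left (E_q hA i i r l hl (fun h => absurd h hr)) (E_q hA j i r l hl (fun h => absurd h hr))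
      (rfl : T a i j r = _), ← zpow_add₀ v_ne, hA.2.1, hA.1 j i, h]
    congr 2
    ring

theorem T_Ek (hA : IsCartan a) {i j k : I} (r l : ℤ) (hl : l < r) (h : a i j = -1)
    (hi : r = l + 1 → i ≠ k) (hj : r = l + 1 → j ≠ k) :
    T a i j r * E a k l = v ^ (-(sgn (r - l)) * (a i k + a j k)) • (E a k l * T a i j r) := by
  rw [qc_left (E_q hA i k r l hl hi) (E_q hA j k r l hl hj)
      (rfl : T a i j r = _), ← zpow_add₀ v_ne]
  congr 2
  ring

theorem Ek_T (hA : IsCartan a) {i j k : I} (r l : ℤ) (hl : l < r) (h : a i j = -1)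
    (hi : r = l + 1 → k ≠ i) (hj : r = l + 1 → k ≠ j) :
    E a k r * T a i j l = v ^ (-(sgn (r - l)) * (a i k + a j k)) • (T a i j l * E a k r) := by
  rw [qc_right (E_q hA k i r l hl hi) (E_q hA k j r l hl hj)
      (rfl : T a i j l = _), ← zpow_add₀ v_ne, hA.1 k i, hA.1 k j]
  congr 2
  ring

theorem T_T (hA : IsCartan a) {i j k : I} (r l : ℤ) (hl : l < r) (hj : a i j = -1)
    (hk : a i k = -1) (hjk : r = l + 1 → j ≠ k) :
    T a i j r * T a i k l = v ^ (-(sgn (r - l)) * a j k) • (T a i k l * T a i j r) := by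
  have hik : i ≠ k := by
    rintro rfl
    rw [hA.2.1] at hk
    omega
  rw [qc_right (T_Ei hA r l hl hj) (T_Ek hA r l hl hj (fun _ => hik) hjk)
      (rfl : T a i k l = _), ← zpow_add₀ v_ne, hk]
  congr 2
  ring

open Classical in
/-- image of `E_{j,m}` -/
def sE (a : I → I → ℤ) (i j : I) (m : ℤ) : A a :=
  if j = i then E a i (m + 1) * Kinv a i m else if a i j = -1 then T a i j m else E a j m

open Classical in
/-- image of `K_{j,m}` -/
def sK (a : I → I → ℤ) (i j : I) (m : ℤ) : A a :=
  if j = i then Kinv a i m else if a i j = -1 then K a i m * K a j m else K a j m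

open Classical in
/-- image of `K_{j,m}⁻¹` -/
def sKinv (a : I → I → ℤ) (i j : I) (m : ℤ) : A a :=
  if j = i then K a i m else if a i j = -1 then Kinv a i m * Kinv a j m else Kinv a j m

/-- images of generators -/
def sGen (a : I → I → ℤ) (i : I) : Gen I → A a
  | .E j m => sE a i j m
  | .K j m => sK a i j m
  | .Kinv j m => sKinv a i j m

theorem sE_self (i : I) (m : ℤ) : sE a i i m = E a i (m + 1) * Kinv a i m := by simp [sE]

theorem ne_of {i j : I} (hA : IsCartan a) (h : a i j = -1 ∨ a i j = 0) : j ≠ i := by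
  rintro rfl
  rw [hA.2.1] at h
  omega

theorem sE_adj (hA : IsCartan a) {i j : I} (m : ℤ) (h : a i j = -1) : sE a i j m = T a i j m := by
  simp [sE, ne_of hA (.inl h), h]

theorem sE_zero (hA : IsCartan a) {i j : I} (m : ℤ) (h : a i j = 0) : sE a i j m = E a j m := by
  simp [sE, ne_of hA (.inr h), h]

theorem sK_self (i : I) (m : ℤ) : sK a i i m = Kinv a i m := by simp [sK]

theorem sK_adj (hA : IsCartan a) {i j : I} (m : ℤ) (h : a i j = -1) :
    sK a i j m = K a i m * K a j m := by
  simp [sK, ne_of hA (.inl h), h]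

theorem sK_zero (hA : IsCartan a) {i j : I} (m : ℤ) (h : a i j = 0) : sK a i j m = K a j m := by
  simp [sK, ne_of hA (.inr h), h]

theorem cases3 (hA : IsCartan a) (i j : I) : j = i ∨ a i j = -1 ∨ a i j = 0 := by
  by_cases h : j = i
  · exact .inl h
  · rcases hA.2.2 i j (Ne.symm h) with h | h
    · exact .inr (.inr h)
    · exact .inr (.inl h)

theorem sK_comm (i j : I) (m : ℤ) (x : A a) : sK a i j m * x = x * sK a i j m := by
  unfold sK
  split_ifs
  · exact Kinv_comm i m x
  · rw [mul_assoc, K_comm j m x, ← mul_assoc, K_comm i m x, mul_assoc]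
  · exact K_comm j m x

theorem sK_sKinv (i j : I) (m : ℤ) : sK a i j m * sKinv a i j m = 1 := by
  unfold sK sKinv
  split_ifs
  · exact Kinv_K i m
  · rw [K_comm i m (K a j m), mul_assoc, ← mul_assoc (K a i m), K_Kinv, one_mul, K_Kinv]
  · exact K_Kinv j m

/-- scaling by a central element on the left factor -/
theorem q_cent {i : I} {m : ℤ} {x y : A a} {c : F₀} (h : x * y = c • (y * x)) :
    (x * Kinv a i m) * y = c • (y * (x * Kinv a i m)) := by
  rw [mul_assoc, Kinv_comm, ← mul_assoc, h, smul_mul_assoc, mul_assoc]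

theorem q_cent' {i : I} {m : ℤ} {x y : A a} {c : F₀} (h : y * x = c • (x * y)) :
    y * (x * Kinv a i m) = c • ((x * Kinv a i m) * y) := by
  rw [← mul_assoc, h, smul_mul_assoc, mul_assoc x, mul_assoc x, Kinv_comm]

theorem sE_q (hA : IsCartan a) (i j k : I) (r l : ℤ) (hl : l < r) (hjk : r = l + 1 → j ≠ k) :
    sE a i j r * sE a i k l = v ^ (-(sgn (r - l)) * a j k) • (sE a i k l * sE a i j r) := by
  rcases cases3 hA i j with rfl | hj | hj
  · rw [sE_self]
    rcases cases3 hA j k with rfl | hk | hk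
    · rw [sE_self]
      apply q_cent
      apply q_cent'
      rw [E_q hA k k (r + 1) (l + 1) (by omega) (fun h => absurd rfl (hjk (by omega)))]
      congr 4
      ring
    · rw [sE_adj hA l hk]
      apply q_cent
      rw [Ek_T hA (r + 1) l (by omega) hk (by omega) (by omega), hA.1 k j, hk, hA.2.1,
        show r + 1 - l = (r - l) + 1 by ring, sgn_succ]
      congr 2
      ring
    · rw [sE_zero hA l hk]
      apply q_cent
      rw [E_q hA j k (r + 1) l (by omega) (by omega), hk]
      simp
  · rw [sE_adj hA r hj]
    rcases cases3 hA i k with rfl | hk | hk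
    · rw [sE_self]
      apply q_cent'
      rw [hA.1 j k, hj]
      by_cases hr : r = l + 1
      · subst hr
        rw [T_E_same _ hj, add_sub_cancel_left, sgn_one]
        norm_num
      · rw [T_Ei hA r (l + 1) (by omega) hj, show r - (l + 1) = (r - l) - 1 by ring, sgn_pred]
        congr 2
        ring
    · rw [sE_adj hA l hk]
      exact T_T hA r l hl hj hk hjk
    · rw [sE_zero hA l hk, T_Ek hA r l hl hj (fun _ => (ne_of hA (.inr hk)).symm) hjk, hk, zero_add]
  · rw [sE_zero hA r hj]
    rcases cases3 hA i k with rfl | hk | hk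
    · rw [sE_self]
      apply q_cent'
      rw [hA.1 j k, hj]
      by_cases hr : r = l + 1
      · subst hr
        rw [E_comm _ (by rw [hA.1, hj])]
        simp
      · rw [E_q hA j k r (l + 1) (by omega) ?_, hA.1 j k, hj]
        · simp
        · intro _
          exact ne_of hA (.inr hj)
    · rw [sE_adj hA l hk, Ek_T hA r l hl hk (fun _ => ne_of hA (.inr hj)) hjk, hj, zero_add,
        hA.1 k j]
    · rw [sE_zero hA l hk]
      exact E_q hA j k r l hl hjk

theorem sE_eq (hA : IsCartan a) (i j : I) (m : ℤ) : sE a i j (m + 1) * sE a i j m =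
    v ^ 2 • (sE a i j m * sE a i j (m + 1)) + (1 - v ^ 2) • sK a i j m := by
  rcases cases3 hA i j with rfl | hj | hj
  · rw [sE_self, sE_self, sK_self]
    have e := E_eq hA j (m + 1)
    have h1 : E a j (m + 1 + 1) * Kinv a j (m + 1) * (E a j (m + 1) * Kinv a j m) =
        E a j (m + 1 + 1) * E a j (m + 1) * (Kinv a j (m + 1) * Kinv a j m) := by
      rw [mul_assoc, ← mul_assoc (Kinv a j (m + 1)), Kinv_comm j (m + 1) (E a j (m + 1))]
      simp only [mul_assoc]
    have h2 : E a j (m + 1) * Kinv a j m * (E a j (m + 1 + 1) * Kinv a j (m + 1)) =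
        E a j (m + 1) * E a j (m + 1 + 1) * (Kinv a j (m + 1) * Kinv a j m) := by
      rw [mul_assoc, ← mul_assoc (Kinv a j m), Kinv_comm j m (E a j (m + 1 + 1)),
        mul_assoc (E a j (m + 1 + 1)), Kinv_comm j m (Kinv a j (m + 1))]
      simp only [mul_assoc]
    rw [h1, h2, e, add_mul, smul_mul_assoc, smul_mul_assoc, ← mul_assoc (K a j (m + 1)), K_Kinv,
      one_mul, add_comm]
  · rw [sE_adj hA _ hj, sE_adj hA _ hj, sK_adj hA _ hj]
    exact (shift hA m hj).2.1
  · rw [sE_zero hA _ hj, sE_zero hA _ hj, sK_zero hA _ hj, E_eq hA, add_comm]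

theorem comm_T_E (hA : IsCartan a) {i j k : I} (m : ℤ) (hk : a i k = 0)
    (h : a j k = 0) : T a i j m * E a k m = E a k m * T a i j m := by
  have h1 : E a i m * E a k m = (1 : F₀) • (E a k m * E a i m) := by rw [one_smul, E_comm m hk]
  have h2 : E a j m * E a k m = (1 : F₀) • (E a k m * E a j m) := by rw [one_smul, E_comm m h]
  rw [qc_left h1 h2 (rfl : T a i j m = _), mul_one, one_smul]

theorem sE_comm (hA : IsCartan a) (i j k : I) (m : ℤ) (h : a j k = 0) :
    sE a i j m * sE a i k m = sE a i k m * sE a i j m := by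
  have key : ∀ k, a i k = 0 → sE a i i m * sE a i k m = sE a i k m * sE a i i m := by
    intro k hk
    rw [sE_self, sE_zero hA _ hk]
    have := E_q hA i k (m + 1) m (by omega) (fun _ => (ne_of hA (.inr hk)).symm)
    rw [hk, mul_zero, zpow_zero] at this
    simpa using q_cent (i := i) (m := m) this
  rcases cases3 hA i j with rfl | hj | hj
  · exact key k h
  · rcases cases3 hA i k with rfl | hk | hk
    · rw [hA.1] at h
      exact (key j h).symm
    · rw [sE_adj hA _ hj, sE_adj hA _ hk, T_eq, T_eq, smul_mul_smul_comm, smul_mul_smul_comm,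
        comm_of (E a i m) (E a j m) (E a k m) _ _ v⁻¹ (inv_ne_zero v_ne) two_ne (E_T' i j m)
          (E_T'_q m hj) (E_T' i k m) (E_T'_q m hk) (E_comm m h)]
    · rw [sE_adj hA _ hj, sE_zero hA _ hk]
      exact comm_T_E hA m hk h
  · rcases cases3 hA i k with rfl | hk | hk
    · rw [hA.1] at h
      exact (key j h).symm
    · rw [sE_zero hA _ hj, sE_adj hA _ hk]
      exact (comm_T_E hA m hj (by rw [hA.1, h])).symm
    · rw [sE_zero hA _ hj, sE_zero hA _ hk]
      exact E_comm m h

theorem serre_cent1 {x y z : A a} (hz : ∀ r, z * r = r * z) (h : Serre v x y) :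
    Serre v (x * z) y := by
  unfold Serre at *
  have e : (x ^ 2 * y - (v + v⁻¹) • (x * y * x) + y * x ^ 2) * (z * z) = 0 := by rw [h, zero_mul]
  rw [← e]
  have m1 : z * x = x * z := hz x
  have m2 : z * y = y * z := hz y
  have n1 : ∀ r, z * (x * r) = x * (z * r) := fun r => by rw [← mul_assoc, hz x, mul_assoc]
  have n2 : ∀ r, z * (y * r) = y * (z * r) := fun r => by rw [← mul_assoc, hz y, mul_assoc]
  simp only [pow_two, mul_assoc, add_mul, sub_mul, smul_mul_assoc, m1, m2, n1, n2]

theorem serre_cent2 {x y z : A a} (hz : ∀ r, z * r = r * z) (h : Serre v y x) :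
    Serre v y (x * z) := by
  unfold Serre at *
  have e : (y ^ 2 * x - (v + v⁻¹) • (y * x * y) + x * y ^ 2) * z = 0 := by rw [h, zero_mul]
  rw [← e]
  have m2 : z * y = y * z := hz y
  have n2 : ∀ r, z * (y * r) = y * (z * r) := fun r => by rw [← mul_assoc, hz y, mul_assoc]
  simp only [pow_two, mul_assoc, add_mul, sub_mul, smul_mul_assoc, m2, n2]

theorem sE_serre (hA : IsCartan a) (i j k : I) (m : ℤ) (h : a j k = -1) :
    Serre v (sE a i j m) (sE a i k m) := by
  have hv := v_ne
  rcases cases3 hA i j with rfl | hj | hj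
  · rw [sE_self, sE_adj hA _ h]
    apply serre_cent1 (Kinv_comm j m)
    apply serreXT _ _ _ v v_ne (shift hA m h).2.2
    have e := E_q hA j k (m + 1) m (by omega) (fun _ => (ne_of hA (.inl h)).symm)
    rw [h, add_sub_cancel_left, sgn_one] at e
    norm_num at e
    rw [mul_smul_comm, ← mul_assoc, ← K_comm, mul_assoc, e, smul_mul_assoc, mul_smul_comm,
      smul_comm, mul_assoc]
  · rcases cases3 hA i k with rfl | hk | hk
    · rw [sE_self, sE_adj hA _ hj]
      apply serre_cent2 (Kinv_comm k m)
      apply serreTX _ _ _ v v_ne (shift hA m hj).2.2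
      rw [mul_smul_comm, ← mul_assoc, ← K_comm, mul_assoc, T_E_same' hA m hj, smul_mul_assoc,
        mul_smul_comm, smul_comm, mul_assoc]
    · rw [sE_adj hA _ hj, sE_adj hA _ hk, T_eq, T_eq]
      apply Serre.smul
      exact serre3 (E a i m) (E a j m) (E a k m) _ _ v⁻¹ v (inv_ne_zero v_ne) two_ne three_ne
        (E_T' i j m) (E_T'_q m hj) (E_T' i k m) (E_T'_q m hk) (E_serre m h)
    · rw [sE_adj hA _ hj, sE_zero hA _ hk, T_eq]
      have := serre2 (E a i m) (E a j m) (E a k m) _ v⁻¹ v (inv_ne_zero v_ne) two_ne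
        (E_T' i j m) (E_T'_q m hj) (E_comm m hk) (E_serre m h)
      simpa using this.smul ((v - v⁻¹)⁻¹ * sq) 1
  · rcases cases3 hA i k with rfl | hk | hk
    · rw [hA.1] at h
      omega
    · rw [sE_zero hA _ hj, sE_adj hA _ hk, T_eq]
      have := serre1 (E a i m) (E a k m) (E a j m) _ v⁻¹ v
        (E_T' i k m) (E_comm m hj) (E_serre m h)
      simpa using this.smul 1 ((v - v⁻¹)⁻¹ * sq)
    · rw [sE_zero hA _ hj, sE_zero hA _ hk]
      exact E_serre m h

/-- the lift to the free algebra -/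
def sFree (a : I → I → ℤ) (i : I) : FreeAlgebra F₀ (Gen I) →ₐ[F₀] A a :=
  FreeAlgebra.lift F₀ (sGen a i)

theorem sFree_e (i j : I) (m : ℤ) : sFree a i (e j m) = sE a i j m := by
  simp [sFree, e, sGen]
theorem sFree_κ (i j : I) (m : ℤ) : sFree a i (κ j m) = sK a i j m := by
  simp [sFree, κ, sGen]
theorem sFree_κ' (i j : I) (m : ℤ) : sFree a i (κ' j m) = sKinv a i j m := by
  simp [sFree, κ', sGen]

theorem sFree_rel (hA : IsCartan a) (i : I) ⦃x y : FreeAlgebra F₀ (Gen I)⦄ (h : Rel a x y) :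
    sFree a i x = sFree a i y := by
  induction h with
  | sd0a j m => rw [map_mul, sFree_κ, sFree_κ', map_one, sK_sKinv]
  | sd0b j m => rw [map_mul, sFree_κ, sFree_κ', map_one, ← sK_comm, sK_sKinv]
  | sd1 j m x => rw [map_mul, map_mul, sFree_κ, sK_comm]
  | sd2 j k m h => rw [map_mul, map_mul, sFree_e, sFree_e, sE_comm hA i j k m h]
  | sd3 j k m h =>
    simp only [map_add, map_sub, map_smul, map_mul, map_pow, map_zero, sFree_e]
    exact sE_serre hA i j k m h
  | sd4_ne j k m h =>
    simp only [map_smul, map_mul, sFree_e]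
    rw [sE_q hA i j k (m + 1) m (by omega) (fun _ => h), add_sub_cancel_left, sgn_one, neg_neg,
      one_mul]
  | sd4_eq j m =>
    simp only [map_add, map_smul, map_mul, sFree_e, sFree_κ]
    rw [sE_eq hA, hA.2.1]
    norm_cast
  | sd5 j k r l h =>
    simp only [map_smul, map_mul, sFree_e]
    rw [sE_q hA i k j r l (by omega) (by omega), hA.1 k j]

theorem Kinv_unique (σ τ : A a →ₐ[F₀] A a) (j : I) (m : ℤ) (h : σ (K a j m) = τ (K a j m)) :
    σ (Kinv a j m) = τ (Kinv a j m) := by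
  have h1 : σ (Kinv a j m) * σ (K a j m) = 1 := by rw [← map_mul, Kinv_K, map_one]
  have h2 : τ (K a j m) * τ (Kinv a j m) = 1 := by rw [← map_mul, K_Kinv, map_one]
  rw [h] at h1
  exact left_inv_eq_right_inv h1 h2

end alg
end SDAux

/-- For every `i ∈ I` there is a unique `F`-algebra endomorphism `σᵢ` of
`𝒜` satisfying the braid group action formulas on the generators `E_{j,m}` and `K_{j,m}`. -/
theorem sigma_existsUnique (I : Type) [Fintype I] (a : I → I → ℤ)
    (hA : IsCartan a) (i : I) :
    ∃! σ : A a →ₐ[F₀] A a, SigmaSpec a i σ := by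
  open SDAux in
  refine ⟨RingQuot.liftAlgHom F₀ ⟨sFree a i, sFree_rel hA i⟩, ?_, ?_⟩
  · refine ⟨fun m => ?_, fun j m h => ?_, fun j m h => ?_, fun m => ?_, fun j m h => ?_,
      fun j m h => ?_⟩
    · rw [E, RingQuot.liftAlgHom_mkAlgHom_apply, sFree_e, sE_self]
    · rw [E, RingQuot.liftAlgHom_mkAlgHom_apply, sFree_e, sE_adj hA m h]
    · rw [E, RingQuot.liftAlgHom_mkAlgHom_apply, sFree_e, sE_zero hA m h, E]
    · rw [K, RingQuot.liftAlgHom_mkAlgHom_apply, sFree_κ, sK_self]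
    · rw [K, RingQuot.liftAlgHom_mkAlgHom_apply, sFree_κ, sK_adj hA m h, K, K]
    · rw [K, RingQuot.liftAlgHom_mkAlgHom_apply, sFree_κ, sK_zero hA m h, K]
  · rintro τ ⟨t1, t2, t3, t4, t5, t6⟩
    have hE : ∀ j m, τ (E a j m) = sE a i j m := by
      intro j m
      rcases cases3 hA i j with rfl | h | h
      · rw [t1, sE_self]
      · rw [t2 j m h, sE_adj hA m h]
      · rw [t3 j m h, sE_zero hA m h]
    have hK : ∀ j m, τ (K a j m) = sK a i j m := by
      intro j m
      rcases cases3 hA i j with rfl | h | h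
      · rw [t4, sK_self]
      · rw [t5 j m h, sK_adj hA m h]
      · rw [t6 j m h, sK_zero hA m h]
    have hK' : ∀ j m, τ (K a j m) =
        RingQuot.liftAlgHom F₀ ⟨sFree a i, sFree_rel hA i⟩ (K a j m) := by
      intro j m
      rw [hK, K, RingQuot.liftAlgHom_mkAlgHom_apply, sFree_κ]
    apply RingQuot.ringQuot_ext'
    apply FreeAlgebra.hom_ext
    funext g
    cases g with
    | E j m =>
      have : τ (E a j m) = RingQuot.liftAlgHom F₀ ⟨sFree a i, sFree_rel hA i⟩ (E a j m) := by
        rw [hE, E, RingQuot.liftAlgHom_mkAlgHom_apply, sFree_e]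
      exact this
    | K j m => exact hK' j m
    | Kinv j m => exact Kinv_unique τ _ j m (hK' j m)
end
end

section
/- For all i, j ∈ I with a_{ij} = −1, the automorphisms σ_i and σ_j of 𝒜 satisfy the braid relation σ_i ∘ σ_j ∘ σ_i = σ_j ∘ σ_i ∘ σ_j. -/
/-!
Braid group action on the twisted semi-derived Hall algebra (Contu, arXiv:2410.18604).

We work with the algebra `𝒜 = 𝒮𝒟ℋ_tw(C^b(𝒫))` given by its presentation
(Proposition `prop_presenentation_semiderived_E_i` of the paper): generators
`E_{i,m}`, `K_{i,m}`, `K_{i,m}⁻¹` (`i ∈ I`, `m ∈ ℤ`) over `F = ℚ(v^{1/2})`,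
subject to the relations (SD0)–(SD5).
-/

noncomputable section

open SDHall


section Helpers

variable {F R : Type*} [Field F] [Ring R] [Algebra F R]

/-- The `s`-bracket `c (s x y - s⁻¹ y x)`. -/
def br (c s : F) (x y : R) : R := c • (s • (x * y) - s⁻¹ • (y * x))

theorem br_swap (c s : F) (hs : s ≠ 0) (hc : c * (s ^ 2 - (s ^ 2)⁻¹) = 1) (x X y K : R)
    (h1 : X * x = ((s ^ 2) ^ 2) • (x * X) + (1 - (s ^ 2) ^ 2) • K)
    (h2 : X * y = (s ^ 2)⁻¹ • (y * X)) (hK : y * K = K * y) :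
    br c s (br c s x y) X = K * y := by
  have e1 : X * (x * y) = (s ^ 2) • (x * (y * X)) + (1 - (s ^ 2) ^ 2) • (K * y) := by
    rw [← mul_assoc, h1, add_mul, smul_mul_assoc, smul_mul_assoc, mul_assoc, h2, mul_smul_comm,
      smul_smul]
    congr 2
    field_simp
  have e2 : X * (y * x) = (s ^ 2) • (y * (x * X)) + ((s ^ 2)⁻¹ * (1 - (s ^ 2) ^ 2)) • (K * y) := by
    rw [← mul_assoc, h2, smul_mul_assoc, mul_assoc, h1, mul_add, mul_smul_comm, mul_smul_comm, hK,
      smul_add, smul_smul, smul_smul]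
    congr 2
    field_simp
  have hc' : s ^ 2 - (s ^ 2)⁻¹ ≠ 0 := right_ne_zero_of_mul_eq_one hc
  have hc'' : c = (s ^ 2 - (s ^ 2)⁻¹)⁻¹ := eq_inv_of_mul_eq_one_left hc
  have hs4 : s ^ 4 - 1 ≠ 0 := by
    intro h
    apply hc'
    field_simp
    linear_combination h
  have hc3 : c = s ^ 2 / (s ^ 4 - 1) := by
    rw [hc'']
    have : s ^ 2 - (s ^ 2)⁻¹ = (s ^ 4 - 1) / s ^ 2 := by field_simp
    rw [this, inv_div]
  simp only [br, mul_sub, sub_mul, mul_smul_comm, smul_mul_assoc, mul_assoc, e1, e2]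
  rw [hc3]
  match_scalars <;> field_simp <;> ring

theorem br_assoc (c s : F) (hs : s ≠ 0) (x y z : R) (h : y * z = z * y) :
    br c s y (br c s x z) = br c s (br c s y x) z := by
  have h' : ∀ w : R, y * (z * w) = z * (y * w) := fun w => by
    rw [← mul_assoc, h, mul_assoc]
  simp only [br, mul_sub, sub_mul, mul_smul_comm, smul_mul_assoc, mul_assoc, h, h']
  match_scalars <;> field_simp <;> ring

theorem br_triangle (c s : F) (hs : s ≠ 0) (hq : s ^ 4 + 1 ≠ 0) (x y z : R)
    (hxy : x ^ 2 * y - (s ^ 2 + (s ^ 2)⁻¹) • (x * y * x) + y * x ^ 2 = 0)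
    (hxz : x ^ 2 * z - (s ^ 2 + (s ^ 2)⁻¹) • (x * z * x) + z * x ^ 2 = 0)
    (hyz : y ^ 2 * z - (s ^ 2 + (s ^ 2)⁻¹) • (y * z * y) + z * y ^ 2 = 0) :
    br c s y (br c s (br c s x y) (br c s x z)) = br c s x (br c s (br c s y x) (br c s y z)) := by
  have key : br c s y (br c s (br c s x y) (br c s x z))
      - br c s x (br c s (br c s y x) (br c s y z))
      = (c ^ 4 * s ^ 2 / (s ^ 4 + 1)) •
        (s ^ 4 • ((x ^ 2 * y - (s ^ 2 + (s ^ 2)⁻¹) • (x * y * x) + y * x ^ 2) * (y * z))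
        - s ^ 4 • (y * (x ^ 2 * y - (s ^ 2 + (s ^ 2)⁻¹) • (x * y * x) + y * x ^ 2) * z)
        - (s ^ 4)⁻¹ • (z * (x ^ 2 * y - (s ^ 2 + (s ^ 2)⁻¹) • (x * y * x) + y * x ^ 2) * y)
        + (s ^ 4)⁻¹ • (z * y * (x ^ 2 * y - (s ^ 2 + (s ^ 2)⁻¹) • (x * y * x) + y * x ^ 2))
        - ((x ^ 2 * z - (s ^ 2 + (s ^ 2)⁻¹) • (x * z * x) + z * x ^ 2) * (y * y))
        + (s ^ 2 + (s ^ 2)⁻¹) •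
            (y * (x ^ 2 * z - (s ^ 2 + (s ^ 2)⁻¹) • (x * z * x) + z * x ^ 2) * y)
        - (y * y * (x ^ 2 * z - (s ^ 2 + (s ^ 2)⁻¹) • (x * z * x) + z * x ^ 2))
        + ((y ^ 2 * z - (s ^ 2 + (s ^ 2)⁻¹) • (y * z * y) + z * y ^ 2) * (x * x))
        - (s ^ 2 + (s ^ 2)⁻¹) •
            (x * (y ^ 2 * z - (s ^ 2 + (s ^ 2)⁻¹) • (y * z * y) + z * y ^ 2) * x)
        + (x * x * (y ^ 2 * z - (s ^ 2 + (s ^ 2)⁻¹) • (y * z * y) + z * y ^ 2))) := by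
    simp only [br, pow_two x, pow_two y, mul_sub, sub_mul, mul_add, add_mul, mul_smul_comm,
      smul_mul_assoc, mul_assoc]
    match_scalars <;> field_simp <;> ring
  rw [hxy, hxz, hyz] at key
  simp only [mul_zero, zero_mul, smul_zero, sub_zero, add_zero] at key
  exact sub_eq_zero.mp key

end Helpers

namespace SDHall

theorem sq_ne : sq ≠ 0 := RatFunc.X_ne_zero

theorem sq_pow_add : sq ^ 4 + 1 ≠ 0 := by
  have h : (Polynomial.X ^ 4 + Polynomial.C 1 : Polynomial ℚ) ≠ 0 :=
    Polynomial.X_pow_add_C_ne_zero (by norm_num) 1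
  have h2 := (RatFunc.algebraMap_ne_zero h)
  simpa [sq] using h2

theorem sq_pow_sub : sq ^ 4 - 1 ≠ 0 := by
  have h : (Polynomial.X ^ 4 - Polynomial.C 1 : Polynomial ℚ) ≠ 0 :=
    Polynomial.X_pow_sub_C_ne_zero (by norm_num) 1
  have h2 := (RatFunc.algebraMap_ne_zero h)
  simpa [sq] using h2

theorem c_mul : (v - v⁻¹)⁻¹ * (sq ^ 2 - (sq ^ 2)⁻¹) = 1 := by
  apply inv_mul_cancel₀
  intro h
  apply sq_pow_sub
  have h0 := sq_ne
  change sq ^ 2 - (sq ^ 2)⁻¹ = 0 at h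
  field_simp at h
  linear_combination h

variable {I : Type} (a : I → I → ℤ)

theorem rel_eq {x y : FreeAlgebra F₀ (Gen I)} (h : Rel a x y) :
    RingQuot.mkAlgHom F₀ (Rel a) x = RingQuot.mkAlgHom F₀ (Rel a) y :=
  RingQuot.mkAlgHom_rel F₀ h

theorem K_Kinv (i : I) (m : ℤ) : K a i m * Kinv a i m = 1 := by
  have h0 := rel_eq a (Rel.sd0a i m)
  simp only [map_mul, map_one] at h0
  exact h0

theorem Kinv_K (i : I) (m : ℤ) : Kinv a i m * K a i m = 1 := by
  have h0 := rel_eq a (Rel.sd0b i m)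
  simp only [map_mul, map_one] at h0
  exact h0

theorem K_comm (i : I) (m : ℤ) (x : A a) : K a i m * x = x * K a i m := by
  obtain ⟨x, rfl⟩ := RingQuot.mkAlgHom_surjective F₀ (Rel a) x
  have h0 := rel_eq a (Rel.sd1 i m x)
  simp only [map_mul, map_one] at h0
  exact h0

theorem Kinv_comm (i : I) (m : ℤ) (x : A a) : Kinv a i m * x = x * Kinv a i m := by
  calc Kinv a i m * x = Kinv a i m * (x * (K a i m * Kinv a i m)) := by rw [K_Kinv, mul_one]
    _ = Kinv a i m * (K a i m * x) * Kinv a i m := by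
      rw [K_comm a i m x]; simp only [mul_assoc]
    _ = x * Kinv a i m := by rw [← mul_assoc, Kinv_K, one_mul]

theorem E_comm (i j : I) (m : ℤ) (h : a i j = 0) : E a i m * E a j m = E a j m * E a i m := by
  have h0 := rel_eq a (Rel.sd2 i j m h)
  simp only [map_mul, map_one] at h0
  exact h0

theorem E_serre (i j : I) (m : ℤ) (h : a i j = -1) :
    E a i m ^ 2 * E a j m - (sq ^ 2 + (sq ^ 2)⁻¹) • (E a i m * E a j m * E a i m)
      + E a j m * E a i m ^ 2 = 0 := by
  have := rel_eq a (Rel.sd3 i j m h)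
  simp only [map_add, map_sub, map_mul, map_smul, map_pow, map_zero] at this
  exact this

theorem E_ne (i j : I) (m : ℤ) (hne : i ≠ j) (h : a i j = -1) :
    E a i (m + 1) * E a j m = (sq ^ 2)⁻¹ • (E a j m * E a i (m + 1)) := by
  have := rel_eq a (Rel.sd4_ne (a := a) i j m hne)
  rw [h, zpow_neg_one] at this
  simp only [map_mul, map_smul] at this
  exact this

theorem E_eq (i : I) (m : ℤ) (h : a i i = 2) :
    E a i (m + 1) * E a i m = ((sq ^ 2) ^ 2) • (E a i m * E a i (m + 1))
      + (1 - (sq ^ 2) ^ 2) • K a i m := by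
  have := rel_eq a (Rel.sd4_eq (a := a) i m)
  rw [h] at this
  simp only [map_add, map_mul, map_smul] at this
  exact this

theorem T_eq (i j : I) (m : ℤ) : T a i j m = br (v - v⁻¹)⁻¹ sq (E a i m) (E a j m) := rfl

theorem map_br {B : Type*} [Ring B] [Algebra F₀ B] (f : B →ₐ[F₀] B) (c s : F₀) (x y : B) :
    f (br c s x y) = br c s (f x) (f y) := by
  simp only [br, map_smul, map_sub, map_mul]

theorem br_mul_right {B : Type*} [Ring B] [Algebra F₀ B] (c s : F₀) (x y k : B)
    (hk : ∀ z, k * z = z * k) : br c s x (y * k) = br c s x y * k := by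
  simp only [br, sub_mul, smul_mul_assoc, mul_assoc, hk]

theorem alg_ext (f g : A a →ₐ[F₀] A a) (hE : ∀ k m, f (E a k m) = g (E a k m))
    (hK : ∀ k m, f (K a k m) = g (K a k m)) : f = g := by
  apply RingQuot.ringQuot_ext'
  apply FreeAlgebra.hom_ext
  funext w
  cases w with
  | E k m => exact hE k m
  | K k m => exact hK k m
  | Kinv k m =>
    change f (Kinv a k m) = g (Kinv a k m)
    have h1 : f (Kinv a k m) * f (K a k m) = 1 := by rw [← map_mul, Kinv_K, map_one]
    have h2 : f (K a k m) * g (Kinv a k m) = 1 := by rw [hK, ← map_mul, K_Kinv, map_one]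
    exact left_inv_eq_right_inv h1 h2

variable {a}

theorem sigma_Kinv {i : I} {σ : A a →ₐ[F₀] A a} (hi : SigmaSpec a i σ) (m : ℤ) :
    σ (Kinv a i m) = K a i m := by
  have h1 : σ (Kinv a i m) * σ (K a i m) = 1 := by rw [← map_mul, Kinv_K, map_one]
  rw [hi.2.2.2.1] at h1
  exact left_inv_eq_right_inv h1 (Kinv_K a i m)

theorem sigma2_E (hA : IsCartan a) {i j : I} (hij : a i j = -1) {σi σj : A a →ₐ[F₀] A a}
    (hi : SigmaSpec a i σi) (hj : SigmaSpec a j σj) (m : ℤ) : σi (σj (E a i m)) = E a j m := by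
  have hji : a j i = -1 := by rw [hA.1, hij]
  have hne : i ≠ j := by
    rintro rfl
    have := hA.2.1 i
    omega
  rw [hj.2.1 i m hji, T_eq, map_br, hi.2.1 j m hij, hi.1, T_eq,
    br_mul_right _ _ _ _ _ (Kinv_comm a i m),
    br_swap _ _ sq_ne c_mul _ _ _ (K a i m) (E_eq a i m (hA.2.1 i)) (E_ne a i j m hne hij)
      (K_comm a i m _).symm, K_comm, mul_assoc, K_Kinv, mul_one]

theorem sigma2_K (hA : IsCartan a) {i j : I} (hij : a i j = -1) {σi σj : A a →ₐ[F₀] A a}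
    (hi : SigmaSpec a i σi) (hj : SigmaSpec a j σj) (m : ℤ) : σi (σj (K a i m)) = K a j m := by
  have hji : a j i = -1 := by rw [hA.1, hij]
  rw [hj.2.2.2.2.1 i m hji, map_mul, hi.2.2.2.2.1 j m hij, hi.2.2.2.1, K_comm, mul_assoc, K_Kinv,
    mul_one]

theorem sigma2_Kinv (hA : IsCartan a) {i j : I} (hij : a i j = -1) {σi σj : A a →ₐ[F₀] A a}
    (hi : SigmaSpec a i σi) (hj : SigmaSpec a j σj) (m : ℤ) :
    σi (σj (Kinv a i m)) = Kinv a j m := by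
  have h1 : σi (σj (Kinv a i m)) * σi (σj (K a i m)) = 1 := by
    rw [← map_mul, ← map_mul, Kinv_K, map_one, map_one]
  rw [sigma2_K hA hij hi hj] at h1
  exact left_inv_eq_right_inv h1 (K_Kinv a j m)

theorem braid_E_self (hA : IsCartan a) {i j : I} (hij : a i j = -1) {σi σj : A a →ₐ[F₀] A a}
    (hi : SigmaSpec a i σi) (hj : SigmaSpec a j σj) (m : ℤ) :
    σi (σj (σi (E a i m))) = σj (σi (σj (E a i m))) := by
  rw [sigma2_E hA hij hi hj, hi.1, map_mul, map_mul, sigma2_E hA hij hi hj,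
    sigma2_Kinv hA hij hi hj, hj.1]

theorem braid_K_self (hA : IsCartan a) {i j : I} (hij : a i j = -1) {σi σj : A a →ₐ[F₀] A a}
    (hi : SigmaSpec a i σi) (hj : SigmaSpec a j σj) (m : ℤ) :
    σi (σj (σi (K a i m))) = σj (σi (σj (K a i m))) := by
  rw [sigma2_K hA hij hi hj, hi.2.2.2.1, sigma2_Kinv hA hij hi hj, hj.2.2.2.1]

/-- The case of `k` adjacent to `i` but not to `j`. -/
theorem braid_E_adj (hA : IsCartan a) {i j k : I} (hij : a i j = -1) {σi σj : A a →ₐ[F₀] A a}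
    (hi : SigmaSpec a i σi) (hj : SigmaSpec a j σj) (hik : a i k = -1) (hjk : a j k = 0) (m : ℤ) :
    σi (σj (σi (E a k m))) = σj (σi (σj (E a k m))) := by
  have hji : a j i = -1 := by rw [hA.1, hij]
  rw [hj.2.2.1 k m hjk, hi.2.1 k m hik, T_eq, map_br, map_br, sigma2_E hA hij hi hj,
    hj.2.2.1 k m hjk, hi.2.1 k m hik, hj.2.1 i m hji, T_eq, T_eq]
  exact br_assoc _ _ sq_ne _ _ _ (E_comm a j k m hjk)

theorem braid_K_adj (hA : IsCartan a) {i j k : I} (hij : a i j = -1) {σi σj : A a →ₐ[F₀] A a}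
    (hi : SigmaSpec a i σi) (hj : SigmaSpec a j σj) (hik : a i k = -1) (hjk : a j k = 0) (m : ℤ) :
    σi (σj (σi (K a k m))) = σj (σi (σj (K a k m))) := by
  have hji : a j i = -1 := by rw [hA.1, hij]
  rw [hj.2.2.2.2.2 k m hjk, hi.2.2.2.2.1 k m hik, map_mul, map_mul,
    sigma2_K hA hij hi hj, hj.2.2.2.2.2 k m hjk, hi.2.2.2.2.1 k m hik, hj.2.2.2.2.1 i m hji,
    mul_assoc]

end SDHall

open SDHall

/-- For `a_{ij} = −1`, the automorphisms `σᵢ`, `σⱼ` of `𝒜` satisfy the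
braid relation `σᵢ ∘ σⱼ ∘ σᵢ = σⱼ ∘ σᵢ ∘ σⱼ`. -/
theorem braid_relation (I : Type) [Fintype I] (a : I → I → ℤ)
    (hA : IsCartan a) (i j : I) (hij : a i j = -1)
    (σi σj : A a →ₐ[F₀] A a) (hi : SigmaSpec a i σi) (hj : SigmaSpec a j σj) :
    σi.comp (σj.comp σi) = σj.comp (σi.comp σj) := by
  have hji : a j i = -1 := by rw [hA.1, hij]
  have cases3 : ∀ k l : I, k = l ∨ a k l = 0 ∨ a k l = -1 := fun k l => by
    by_cases h : k = l
    · exact Or.inl h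
    · exact Or.inr (hA.2.2 k l h)
  apply alg_ext
  · intro k m
    change σi (σj (σi (E a k m))) = σj (σi (σj (E a k m)))
    rcases cases3 i k with rfl | hik | hik
    · exact braid_E_self hA hij hi hj m
    · rcases cases3 j k with rfl | hjk | hjk
      · exact (braid_E_self hA hji hj hi m).symm
      · simp only [hi.2.2.1 k m hik, hj.2.2.1 k m hjk]
      · exact (braid_E_adj hA hji hj hi hjk hik m).symm
    · rcases cases3 j k with rfl | hjk | hjk
      · exact (braid_E_self hA hji hj hi m).symm
      · exact braid_E_adj hA hij hi hj hik hjk m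
      · rw [hi.2.1 k m hik, hj.2.1 k m hjk, T_eq, T_eq, map_br, map_br, map_br, map_br,
          sigma2_E hA hij hi hj, sigma2_E hA hji hj hi, hj.2.1 k m hjk, hi.2.1 k m hik,
          T_eq, T_eq, map_br, map_br, hj.2.1 k m hjk, hi.2.1 k m hik, hi.2.1 j m hij,
          hj.2.1 i m hji]
        simp only [T_eq]
        exact br_triangle _ _ sq_ne sq_pow_add _ _ _ (E_serre a i j m hij) (E_serre a i k m hik)
          (E_serre a j k m hjk)
  · intro k m
    change σi (σj (σi (K a k m))) = σj (σi (σj (K a k m)))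
    rcases cases3 i k with rfl | hik | hik
    · exact braid_K_self hA hij hi hj m
    · rcases cases3 j k with rfl | hjk | hjk
      · exact (braid_K_self hA hji hj hi m).symm
      · simp only [hi.2.2.2.2.2 k m hik, hj.2.2.2.2.2 k m hjk]
      · exact (braid_K_adj hA hji hj hi hjk hik m).symm
    · rcases cases3 j k with rfl | hjk | hjk
      · exact (braid_K_self hA hji hj hi m).symm
      · exact braid_K_adj hA hij hi hj hik hjk m
      · rw [hi.2.2.2.2.1 k m hik, hj.2.2.2.2.1 k m hjk, map_mul, map_mul, map_mul, map_mul,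
          sigma2_K hA hij hi hj, sigma2_K hA hji hj hi, hj.2.2.2.2.1 k m hjk,
          hi.2.2.2.2.1 k m hik, map_mul, map_mul, hj.2.2.2.2.1 k m hjk, hi.2.2.2.2.1 k m hik,
          hi.2.2.2.2.1 j m hij, hj.2.2.2.2.1 i m hji]
        have e1 := K_comm a i m (K a j m)
        have e2 := K_comm a i m (K a k m)
        have e3 : ∀ z, K a j m * (K a i m * z) = K a i m * (K a j m * z) := fun z => by
          rw [← mul_assoc, ← e1, mul_assoc]
        have e4 := K_comm a j m (K a k m)
        simp only [mul_assoc, e3]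
end
end
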